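/- arXiv:1107.1417 — 2 statements merged into one kernel-verified Lean document; each statement's English description precedes it below -/
import Mathlib

section
/- Let 0<q<1 and let k,l be coprime positive integers. Let H be a nonzero complex Hilbert space and let A, B be bounded operators on H with A* = A satisfying AB = q^{-2l}BA, BB* = q^{2kl} A^k ∏_{m=0}^{l-1}(1 - q^{2m}A), B*B = A^k ∏_{m=1}^{l}(1 - q^{-2m}A), and suppose the only closed subspaces of H invariant under each of A, B and B* are {0} and H (irreducibility). Then either H is one-dimensional and A = 0, B = 0, or there exist s ∈ {1,…,l} and a unitary U : ℓ²(ℕ) → H such that U*AU = A_s and U*BU = B_s. -/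
noncomputable section

/-- The Hilbert space `ℓ²(ℕ)` of square-summable complex sequences. -/
abbrev ℓ2 : Type := lp (fun _ : ℕ => ℂ) 2

/-- The standard orthonormal basis vectors of `ℓ²(ℕ)`. -/
def e (p : ℕ) : ℓ2 := lp.single 2 p 1

open Polynomial in
theorem aux_aeval_prod {R : Type*} [Ring R] [Algebra ℝ R] (a : R) (F : ℕ → ℝ[X]) (n : ℕ) :
    aeval a (∏ i ∈ Finset.range n, F i) =
      ((List.range n).map (fun i => aeval a (F i))).prod := by
  induction n with
  | zero => simp
  | succ n ih => rw [Finset.prod_range_succ, map_mul, ih, List.range_succ]; simp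

open Polynomial in
theorem aux_factor {R : Type*} [Ring R] [Algebra ℝ R] (a : R) (P : ℝ[X]) (t : ℝ) :
    ∃ Y : R, aeval a P = algebraMap ℝ R (P.eval t) + Y * (a - algebraMap ℝ R t) := by
  obtain ⟨Q, hQ⟩ := Polynomial.X_sub_C_dvd_sub_C_eval (a := t) (p := P)
  refine ⟨aeval a Q, ?_⟩
  have : P = C (P.eval t) + Q * (X - C t) := by rw [mul_comm, ← hQ]; ring
  conv_lhs => rw [this]
  simp

section
variable {H : Type*} [NormedAddCommGroup H] [InnerProductSpace ℂ H] [CompleteSpace H]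

open Polynomial in
theorem aux_eig (A : H →L[ℂ] H) (P : ℝ[X]) (t : ℝ) (v : H) (hv : A v = (t : ℂ) • v) :
    (aeval A P) v = ((P.eval t : ℝ) : ℂ) • v := by
  obtain ⟨Y, hY⟩ := aux_factor A P t
  rw [hY]
  simp [Algebra.algebraMap_eq_smul_one, hv]

open Polynomial in
theorem aux_spec_step (A B : H →L[ℂ] H) (hsa : star A = A) (c : ℝ)
    (h1 : A * B = c • (B * A)) (g : ℝ[X]) (h3 : star B * B = aeval A g)
    (t : ℝ) (ht : t ∈ spectrum ℝ A) (hg : g.eval t ≠ 0) : c * t ∈ spectrum ℝ A := by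
  by_contra hn
  rw [spectrum.notMem_iff] at hn
  obtain ⟨u, hu⟩ := hn
  apply ht
  rw [spectrum.mem_resolventSet_iff]
  obtain ⟨Y, hY⟩ := aux_factor A g t
  have e1 : (algebraMap ℝ (H →L[ℂ] H) (c * t) - A) * B
      = c • (B * (algebraMap ℝ (H →L[ℂ] H) t - A)) := by
    rw [sub_mul, h1, mul_sub, smul_sub]
    simp [Algebra.algebraMap_eq_smul_one, smul_smul]
  have e2 : B = c • ((↑u⁻¹ : H →L[ℂ] H) * (B * (algebraMap ℝ (H →L[ℂ] H) t - A))) := by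
    rw [← mul_smul_comm, ← e1, ← hu, ← mul_assoc, Units.inv_mul, one_mul]
  set D := algebraMap ℝ (H →L[ℂ] H) t - A with hD
  have e3 : aeval A g = (c • (star B * ↑u⁻¹ * B)) * D := by
    rw [← h3]
    calc star B * B = star B * (c • ((↑u⁻¹ : H →L[ℂ] H) * (B * D))) := by rw [← e2]
      _ = _ := by simp only [mul_smul_comm, smul_mul_assoc, mul_assoc]
  have e4 : ∃ L : H →L[ℂ] H, L * D = 1 := by
    refine ⟨(g.eval t)⁻¹ • (c • (star B * ↑u⁻¹ * B) + Y), ?_⟩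
    have : A - algebraMap ℝ (H →L[ℂ] H) t = - D := by simp [hD]
    rw [smul_mul_assoc, add_mul, ← e3, hY, this]
    simp [Algebra.algebraMap_eq_smul_one, smul_smul, hg]
  obtain ⟨L, hL⟩ := e4
  have hDs : star D = D := by
    rw [hD, star_sub, hsa]; simp [Algebra.algebraMap_eq_smul_one]
  have hR : D * star L = 1 := by
    have := congrArg star hL
    simpa [hDs] using this
  have : L = star L := left_inv_eq_right_inv hL hR
  exact ⟨⟨D, L, by rw [this]; exact hR, hL⟩, rfl⟩

theorem aux_spec_eig [Nontrivial H] (A : H →L[ℂ] H) (hsa : star A = A) (m δ : ℝ) (hδ : 0 < δ)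
    (hm : m ∈ spectrum ℝ A) (hiso : ∀ x ∈ spectrum ℝ A, x ≠ m → δ ≤ |x - m|) :
    ∃ v : H, v ≠ 0 ∧ A v = (m : ℂ) • v := by
  have hA : IsSelfAdjoint A := hsa
  let f : ℝ → ℝ := fun x => max 0 (1 - |x - m| / δ)
  have hf : Continuous f := by fun_prop
  have h1 : (1:ℝ) ∈ spectrum ℝ (cfc f A) := by
    rw [cfc_map_spectrum f A hA hf.continuousOn]
    exact ⟨m, hm, by simp [f]⟩
  have h2 : cfc f A ≠ 0 := by
    intro h
    rw [h] at h1
    simp at h1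
  have h3 : A * cfc f A = m • cfc f A := by
    have : cfc (fun x => id x * f x) A = cfc (fun x => m • f x) A := by
      apply cfc_congr
      intro x hx
      by_cases hxm : x = m
      · simp [hxm]
      · have : f x = 0 := by
          simp only [f]
          apply max_eq_left
          have := (one_le_div hδ).2 (hiso x hx hxm)
          linarith
        simp [this]
    rw [cfc_mul id f A continuousOn_id hf.continuousOn, cfc_id ℝ A, cfc_smul m f A hf.continuousOn] at this
    exact this
  obtain ⟨x, hx⟩ : ∃ x, cfc f A x ≠ 0 := by
    by_contra! h
    exact h2 (ContinuousLinearMap.ext h)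
  refine ⟨_, hx, ?_⟩
  have := congrArg (fun T : H →L[ℂ] H => T x) h3
  simpa using this

theorem aux_spec_nonzero [Nontrivial H] (A : H →L[ℂ] H) (hsa : star A = A) (h0 : A ≠ 0) :
    ∃ t ∈ spectrum ℝ A, t ≠ 0 := by
  have hA : IsSelfAdjoint A := hsa
  by_contra! h
  apply h0
  rw [← cfc_id ℝ A, ← cfc_zero ℝ A]
  apply cfc_congr
  intro x hx
  simp [h x hx]

open Polynomial in
theorem aux_chain [Nontrivial H] (A B : H →L[ℂ] H) (hsa : star A = A) (c : ℝ) (hc : 1 < c)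
    (h1 : A * B = c • (B * A)) (g : ℝ[X]) (h3 : star B * B = aeval A g)
    (t : ℝ) (ht : t ∈ spectrum ℝ A) (h0 : t ≠ 0) :
    ∃ j : ℕ, c ^ j * t ∈ spectrum ℝ A ∧ g.eval (c ^ j * t) = 0 := by
  by_contra! h
  have key : ∀ j : ℕ, c ^ j * t ∈ spectrum ℝ A := by
    intro j
    induction j with
    | zero => simpa using ht
    | succ j ih =>
      have := aux_spec_step A B hsa c h1 g h3 _ ih (h j ih)
      rwa [← mul_assoc, ← pow_succ'] at this
  have hb : ∀ j : ℕ, c ^ j * |t| ≤ ‖A‖ := by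
    intro j
    have := spectrum.norm_le_norm_of_mem (key j)
    rwa [Real.norm_eq_abs, abs_mul, abs_of_pos (by positivity)] at this
  obtain ⟨n, hn⟩ := pow_unbounded_of_one_lt (‖A‖ / |t|) hc
  have := hb n
  rw [div_lt_iff₀ (abs_pos.2 h0)] at hn
  linarith

/-- first polynomial -/
def gpol (q : ℝ) (k l : ℕ) : Polynomial ℝ :=
  Polynomial.X ^ k * ∏ m ∈ Finset.range l, (1 - Polynomial.C (q⁻¹ ^ (2 * (m + 1))) * Polynomial.X)

/-- second polynomial -/
def hpol (q : ℝ) (k l : ℕ) : Polynomial ℝ :=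
  Polynomial.C (q ^ (2 * k * l)) *
   (Polynomial.X ^ k * ∏ m ∈ Finset.range l, (1 - Polynomial.C (q ^ (2 * m)) * Polynomial.X))

theorem aux_csmul (a : ℝ) (n : ℕ) (A : H →L[ℂ] H) : ((a : ℂ) ^ n) • A = (a ^ n) • A := by
  rw [← Complex.ofReal_pow]; rfl

theorem aux_csmul_inv (a : ℝ) (n : ℕ) (A : H →L[ℂ] H) : ((a : ℂ)⁻¹ ^ n) • A = (a⁻¹ ^ n) • A := by
  rw [← Complex.ofReal_inv, ← Complex.ofReal_pow]; rfl

theorem aeval_gpol (q : ℝ) (k l : ℕ) (A : H →L[ℂ] H) : Polynomial.aeval A (gpol q k l) =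
      A ^ k * ((List.range l).map (fun m => 1 - ((q : ℂ)⁻¹ ^ (2 * (m + 1))) • A)).prod := by
  simp only [aux_csmul_inv]
  simp only [gpol, map_mul, aux_aeval_prod, map_pow, Polynomial.aeval_X, map_sub, map_one,
    Polynomial.aeval_C, Algebra.smul_def]

theorem aeval_hpol (q : ℝ) (k l : ℕ) (A : H →L[ℂ] H) : Polynomial.aeval A (hpol q k l) =
      ((q : ℂ) ^ (2 * k * l)) •
      (A ^ k * ((List.range l).map (fun m => 1 - ((q : ℂ) ^ (2 * m)) • A)).prod) := by
  simp only [aux_csmul]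
  simp only [hpol, map_mul, aux_aeval_prod, map_pow, Polynomial.aeval_X, map_sub, map_one,
    Polynomial.aeval_C, Algebra.smul_def]

theorem gpol_root (q : ℝ) (hq0 : 0 < q) (k l : ℕ) (t : ℝ) (h0 : t ≠ 0)
    (h : (gpol q k l).eval t = 0) : ∃ s : ℕ, 1 ≤ s ∧ s ≤ l ∧ t = q ^ (2 * s) := by
  simp only [gpol, Polynomial.eval_mul, Polynomial.eval_pow, Polynomial.eval_X, mul_eq_zero,
    Polynomial.eval_prod, Finset.prod_eq_zero_iff, Finset.mem_range, Polynomial.eval_sub,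
    Polynomial.eval_C, Polynomial.eval_one] at h
  rcases h with h | ⟨m, hm, h⟩
  · exact absurd (eq_zero_of_pow_eq_zero h) h0
  · refine ⟨m + 1, by omega, by omega, ?_⟩
    rw [inv_pow] at h
    field_simp at h
    linarith

/-- the weights -/
def bw (q : ℝ) (k l s p : ℕ) : ℝ := q ^ (k * (l * (p + 1) + s)) *
  ∏ r ∈ Finset.range l, Real.sqrt (1 - q ^ (2 * (l * (p + 1) + s) - 2 * (r + 1)))

theorem bw_pos (q : ℝ) (hq0 : 0 < q) (hq1 : q < 1) (k l s p : ℕ) (hs : 1 ≤ s) :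
    0 < bw q k l s p := by
  unfold bw
  refine mul_pos (by positivity) (Finset.prod_pos ?_)
  intro r hr
  rw [Finset.mem_range] at hr
  apply Real.sqrt_pos.2
  have : q ^ (2 * (l * (p + 1) + s) - 2 * (r + 1)) < 1 := by
    apply pow_lt_one₀ hq0.le hq1
    have : l * (p + 1) = l * p + l := by ring
    omega
  linarith

theorem hpol_eval (q : ℝ) (hq0 : 0 < q) (hq1 : q < 1) (k l s p : ℕ) :
    (hpol q k l).eval (q ^ (2 * (l * p + s))) = bw q k l s p ^ 2 := by
  simp only [hpol, bw, Polynomial.eval_mul, Polynomial.eval_pow, Polynomial.eval_X,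
    Polynomial.eval_prod, Polynomial.eval_sub,
    Polynomial.eval_C, Polynomial.eval_one, mul_pow]
  rw [← mul_assoc]
  congr 1
  · rw [← pow_mul, ← pow_mul, ← pow_add]; congr 1; ring
  · rw [← Finset.prod_pow, ← Finset.prod_range_reflect]
    apply Finset.prod_congr rfl
    intro r hr
    rw [Finset.mem_range] at hr
    rw [Real.sq_sqrt]
    · rw [← pow_add]
      congr 2
      have : l * (p + 1) = l * p + l := by ring
      omega
    · have := pow_le_one₀ (n := (2 * (l * (p + 1) + s) - 2 * (r + 1))) hq0.le hq1.le
      linarith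

theorem aux_zero [Nontrivial H] (A B : H →L[ℂ] H) (hA : A = 0) (hB : B = 0)
    (hirr : ∀ S : Submodule ℂ H, IsClosed (S : Set H) →
      (∀ x ∈ S, A x ∈ S) → (∀ x ∈ S, B x ∈ S) → (∀ x ∈ S, (star B) x ∈ S) →
      S = ⊥ ∨ S = ⊤) : Module.finrank ℂ H = 1 := by
  obtain ⟨v, hv⟩ := exists_ne (0 : H)
  rcases hirr (Submodule.span ℂ {v}) (Submodule.closed_of_finiteDimensional _)
    (by simp [hA]) (by simp [hB]) (by simp [hB]) with h | h
  · simp [hv] at h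
  · rw [← finrank_top, ← h, finrank_span_singleton hv]

end

/-- Classification of bounded irreducible `*`-representations of the
quantum weighted projective line relations: an irreducible pair `(A, B)` of bounded
operators satisfying the relations is either the one-dimensional zero representation, or
unitarily equivalent to one of the representations `π_s`, `s ∈ {1, …, l}`. -/
theorem teardrop_irreducible_representations_classification
    (q : ℝ) (hq0 : 0 < q) (hq1 : q < 1)
    (k l : ℕ) (hk : 0 < k) (hl : 0 < l) (hkl : Nat.Coprime k l)
    {H : Type*} [NormedAddCommGroup H] [InnerProductSpace ℂ H] [CompleteSpace H]
    [Nontrivial H]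
    (A B : H →L[ℂ] H) (hsa : star A = A)
    (h1 : A * B = ((q : ℂ)⁻¹ ^ (2 * l)) • (B * A))
    (h2 : B * star B = ((q : ℂ) ^ (2 * k * l)) •
      (A ^ k * ((List.range l).map (fun m => 1 - ((q : ℂ) ^ (2 * m)) • A)).prod))
    (h3 : star B * B =
      A ^ k * ((List.range l).map (fun m => 1 - ((q : ℂ)⁻¹ ^ (2 * (m + 1))) • A)).prod)
    (hirr : ∀ S : Submodule ℂ H, IsClosed (S : Set H) →
      (∀ x ∈ S, A x ∈ S) → (∀ x ∈ S, B x ∈ S) → (∀ x ∈ S, (star B) x ∈ S) →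
      S = ⊥ ∨ S = ⊤) :
    (Module.finrank ℂ H = 1 ∧ A = 0 ∧ B = 0) ∨
    ∃ s : ℕ, 1 ≤ s ∧ s ≤ l ∧ ∃ U : ℓ2 ≃ₗᵢ[ℂ] H,
      (∀ p : ℕ, A (U (e p)) = ((q : ℂ) ^ (2 * (l * p + s))) • U (e p)) ∧
      B (U (e 0)) = 0 ∧
      (∀ p : ℕ, B (U (e (p + 1))) =
        (((q : ℂ) ^ (k * (l * (p + 1) + s))) *
          ((∏ r ∈ Finset.range l,
            Real.sqrt (1 - q ^ (2 * (l * (p + 1) + s) - 2 * (r + 1))) : ℝ) : ℂ)) •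
          U (e p)) := by
  rw [← aeval_gpol] at h3
  rw [← aeval_hpol] at h2
  rw [aux_csmul_inv] at h1
  by_cases hA0 : A = 0
  · left
    have hB : B = 0 := by
      have : star B * B = 0 := by
        rw [h3, aeval_gpol, hA0, zero_pow hk.ne', zero_mul]
      exact CStarRing.star_mul_self_eq_zero_iff B |>.1 this
    exact ⟨aux_zero A B hA0 hB hirr, hA0, hB⟩
  right
  have hqi : 1 < q⁻¹ ^ (2 * l) := one_lt_pow₀ ((one_lt_inv₀ hq0).2 hq1) (by omega)
  have hspec : ∀ x ∈ spectrum ℝ A, x ≠ 0 → ∃ n : ℕ, x = q ^ (2 * n) := by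
    intro x hx hx0
    obtain ⟨j, -, hj⟩ := aux_chain A B hsa _ hqi h1 _ h3 x hx hx0
    obtain ⟨s, -, -, hs⟩ := gpol_root q hq0 k l _ (mul_ne_zero (by positivity) hx0) hj
    refine ⟨s + l * j, ?_⟩
    rw [← pow_mul, inv_pow] at hs
    rw [inv_mul_eq_iff_eq_mul₀ (by positivity)] at hs
    rw [hs, ← pow_add]
    congr 1; ring
  obtain ⟨t, ht, ht0⟩ := aux_spec_nonzero A hsa hA0
  obtain ⟨j, hj1, hj2⟩ := aux_chain A B hsa _ hqi h1 _ h3 t ht ht0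
  obtain ⟨s, hs1, hs2, hs⟩ := gpol_root q hq0 k l _ (mul_ne_zero (by positivity) ht0) hj2
  rw [hs] at hj1 hj2
  have hq2 : q ^ 2 < 1 := pow_lt_one₀ hq0.le hq1 (by norm_num)
  have hqs : 0 < q ^ (2 * s) := by positivity
  obtain ⟨v, hv0, hv⟩ := aux_spec_eig A hsa (q ^ (2 * s)) (q ^ (2 * s) * (1 - q ^ 2))
    (mul_pos hqs (by linarith)) hj1 (by
      intro x hx hxs
      by_cases hx0 : x = 0
      · rw [hx0, zero_sub, abs_neg, abs_of_pos hqs]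
        nlinarith [sq_nonneg q]
      obtain ⟨n, rfl⟩ := hspec x hx hx0
      rcases lt_trichotomy n s with h | h | h
      · have h' : q ^ (2 * s) ≤ q ^ (2 * n) * q ^ 2 := by
          rw [← pow_add]; exact pow_le_pow_of_le_one hq0.le hq1.le (by omega)
        have h'' : q ^ (2 * s) ≤ q ^ (2 * n) := pow_le_pow_of_le_one hq0.le hq1.le (by omega)
        refine le_trans ?_ (le_abs_self _)
        nlinarith
      · exact absurd (by rw [h]) hxs
      · have h' : q ^ (2 * n) ≤ q ^ (2 * s) * q ^ 2 := by
          rw [← pow_add]; exact pow_le_pow_of_le_one hq0.le hq1.le (by omega)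
        refine le_trans ?_ (neg_le_abs _)
        nlinarith)
  -- the basis
  obtain ⟨w, hw1, hw⟩ : ∃ w : H, ‖w‖ = 1 ∧ A w = ((q ^ (2 * s) : ℝ) : ℂ) • w := by
    refine ⟨((‖v‖⁻¹ : ℝ) : ℂ) • v, ?_, ?_⟩
    · rw [norm_smul]; simp [hv0]
    · rw [map_smul, hv, smul_comm]
  have hadj : ∀ x y : H, inner ℂ (B x) y = inner ℂ x (star B y) := by
    intro x y
    rw [ContinuousLinearMap.star_eq_adjoint, ContinuousLinearMap.adjoint_inner_right]
  have hadj2 : ∀ x y : H, inner ℂ (star B x) y = inner ℂ x (B y) := by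
    intro x y
    rw [ContinuousLinearMap.star_eq_adjoint, ContinuousLinearMap.adjoint_inner_left]
  have hBw : B w = 0 := by
    have h : star B (B w) = 0 := by
      have := aux_eig A (gpol q k l) _ w hw
      rw [← h3, hj2] at this
      simpa using this
    rw [← inner_self_eq_zero (𝕜 := ℂ), hadj, h, inner_zero_right]
  have h1' : A * star B = q ^ (2 * l) • (star B * A) := by
    have := congrArg star h1
    rw [star_mul, star_smul, star_mul, hsa] at this
    rw [this, smul_smul]
    simp only [star_trivial]
    rw [← mul_pow, mul_inv_cancel₀ hq0.ne', one_pow, one_smul]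
  have hbpos := fun p => bw_pos q hq0 hq1 k l s p hs1
  let f : ℕ → H := fun p => Nat.rec w (fun p x => (((bw q k l s p)⁻¹ : ℝ) : ℂ) • (star B) x) p
  have f0 : f 0 = w := rfl
  have fs : ∀ p, f (p + 1) = (((bw q k l s p)⁻¹ : ℝ) : ℂ) • (star B) (f p) := fun p => rfl
  clear_value f
  have fA : ∀ p, A (f p) = ((q ^ (2 * (l * p + s)) : ℝ) : ℂ) • f p := by
    intro p
    induction p with
    | zero => simpa [f0] using hw
    | succ p ih =>
      have h := congrArg (fun T : H →L[ℂ] H => T (f p)) h1'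
      change A (star B (f p)) = (q ^ (2 * l) : ℝ) • star B (A (f p)) at h
      rw [fs, map_smul, h, ih, map_smul, ← Complex.coe_smul, smul_smul, smul_smul, smul_smul,
        ← Complex.ofReal_mul, ← Complex.ofReal_mul, ← Complex.ofReal_mul]
      congr 2
      ring
  have fBB : ∀ p, B (star B (f p)) = ((bw q k l s p ^ 2 : ℝ) : ℂ) • f p := by
    intro p
    have := aux_eig A (hpol q k l) _ _ (fA p)
    rw [← h2, hpol_eval q hq0 hq1] at this
    exact this
  have fB : ∀ p, B (f (p + 1)) = (bw q k l s p : ℂ) • f p := by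
    intro p
    rw [fs, map_smul, fBB, smul_smul, ← Complex.ofReal_mul]
    congr 2
    have := (hbpos p).ne'
    field_simp
  have fB' : ∀ p, star B (f p) = (bw q k l s p : ℂ) • f (p + 1) := by
    intro p
    rw [fs, smul_smul, ← Complex.ofReal_mul, mul_inv_cancel₀ (hbpos p).ne']
    simp
  have fn : ∀ p, inner ℂ (f p) (f p) = (1 : ℂ) := by
    intro p
    induction p with
    | zero => rw [f0, inner_self_eq_norm_sq_to_K, hw1]; simp
    | succ p ih =>
      have h : (bw q k l s p : ℂ) ≠ 0 := by exact_mod_cast (hbpos p).ne'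
      have h2 : inner ℂ (f (p+1)) (star B (f p)) = inner ℂ (B (f (p+1))) (f p) := (hadj _ _).symm
      rw [fB, fB', inner_smul_left, inner_smul_right, ih, Complex.conj_ofReal] at h2
      exact mul_left_cancel₀ h h2
  have hAadj : ∀ x y : H, inner ℂ (A x) y = inner ℂ x (A y) := by
    intro x y
    conv_rhs => rw [← hsa]
    rw [ContinuousLinearMap.star_eq_adjoint, ContinuousLinearMap.adjoint_inner_right]
  have hon : Orthonormal ℂ f := by
    refine ⟨fun p => ?_, fun a b hab => ?_⟩
    · have := fn p
      rw [inner_self_eq_norm_sq_to_K] at this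
      have h : ‖f p‖ ^ 2 = 1 := by
        apply Complex.ofReal_injective
        simpa using this
      exact (pow_eq_one_iff_of_nonneg (norm_nonneg _) (by norm_num)).1 h
    · have h := hAadj (f a) (f b)
      rw [fA, fA, inner_smul_left, inner_smul_right, Complex.conj_ofReal, ← sub_eq_zero,
        ← sub_mul, mul_eq_zero] at h
      rcases h with h | h
      · exfalso
        rw [sub_eq_zero] at h
        have h' : q ^ (2 * (l * a + s)) = q ^ (2 * (l * b + s)) := by exact_mod_cast h
        have := pow_right_injective₀ hq0 hq1.ne h'
        apply hab
        have : l * a = l * b := by omega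
        exact Nat.eq_of_mul_eq_mul_left hl this
      · exact h
  have hinv : ∀ T : H →L[ℂ] H, (∀ p, T (f p) ∈ Submodule.span ℂ (Set.range f)) →
      ∀ x ∈ (Submodule.span ℂ (Set.range f)).topologicalClosure,
        T x ∈ (Submodule.span ℂ (Set.range f)).topologicalClosure := by
    intro T hT x hx
    have hmap : ∀ y ∈ Submodule.span ℂ (Set.range f), T y ∈ Submodule.span ℂ (Set.range f) := by
      intro y hy
      have : Submodule.span ℂ (Set.range f) ≤
          (Submodule.span ℂ (Set.range f)).comap (T : H →ₗ[ℂ] H) := by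
        rw [Submodule.span_le]
        rintro _ ⟨p, rfl⟩
        exact hT p
      exact this hy
    exact map_mem_closure T.continuous hx hmap
  have hmem : ∀ p, f p ∈ Submodule.span ℂ (Set.range f) :=
    fun p => Submodule.subset_span ⟨p, rfl⟩
  have htop : ⊤ ≤ (Submodule.span ℂ (Set.range f)).topologicalClosure := by
    rcases hirr _ (Submodule.isClosed_topologicalClosure (Submodule.span ℂ (Set.range f)))
      (hinv A fun p => by rw [fA]; exact Submodule.smul_mem _ _ (hmem p))
      (hinv B fun p => by
        cases p with
        | zero => rw [f0, hBw]; exact Submodule.zero_mem _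
        | succ p => rw [fB]; exact Submodule.smul_mem _ _ (hmem p))
      (hinv (star B) fun p => by rw [fB']; exact Submodule.smul_mem _ _ (hmem _)) with h | h
    · exfalso
      have : f 0 ∈ (⊥ : Submodule ℂ H) := by
        rw [← h]; exact Submodule.le_topologicalClosure _ (hmem 0)
      rw [Submodule.mem_bot] at this
      have h0 := fn 0
      rw [this] at h0
      simp at h0
    · exact h.ge
  let b := HilbertBasis.mk hon htop
  have hU : ∀ p, b.repr.symm (e p) = f p := by
    intro p
    have : b p = f p := congrFun (HilbertBasis.coe_mk hon htop) p
    rw [← this]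
    exact b.repr_symm_single p
  refine ⟨s, hs1, hs2, b.repr.symm, ?_, ?_, ?_⟩
  · intro p
    rw [hU, fA, Complex.ofReal_pow]
  · rw [hU, f0, hBw]
  · intro p
    rw [hU, hU, fB, bw, Complex.ofReal_mul, Complex.ofReal_pow]
end
end

section
/- Let 0<q<1 and let k,l be coprime positive integers. Define bounded operators Â, B̂ on ℓ²(ℕ) by Â e_n = q^{2(n+1)} e_n, B̂ e_n = 0 for n < l, and B̂ e_n = q^{k(n+1)} ∏_{r=1}^{l}(1 - q^{2(n-r+1)})^{1/2} e_{n-l} for n ≥ l. For s ∈ {1,…,l} let H_s be the closed linear span of {e_{lp+s-1} : p ∈ ℕ}. Then the norm closure of the unital *-subalgebra of bounded operators on ℓ²(ℕ) generated by Â and B̂ equals {λI + K : λ ∈ ℂ, K a compact operator with K(H_s) ⊆ H_s and K*(H_s) ⊆ H_s for all s = 1,…,l}. (This identifies the C*-algebra C(WP_q(k,l)) of continuous functions on the quantum weighted projective line with the direct sum of l copies of the compact operators with adjoined identity.) -/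
noncomputable section

/-- The closed subspace `H_s ⊆ ℓ²(ℕ)` spanned by `{e_{lp+s-1} : p ∈ ℕ}`
(here `s : Fin l` stands for the label `s + 1 ∈ {1, …, l}`). -/
def Hsub (l : ℕ) (s : Fin l) : Submodule ℂ ℓ2 :=
  (Submodule.span ℂ (Set.range fun p : ℕ => e (l * p + (s : ℕ)))).topologicalClosure

open Filter Topology InnerProductSpace

abbrev RO (x y : ℓ2) : ℓ2 →L[ℂ] ℓ2 := rankOne ℂ x y

lemma inner_e_left (n : ℕ) (x : ℓ2) : inner ℂ (e n) x = x n := by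
  simp [e, lp.inner_single_left]

lemma e_apply (n m : ℕ) : (e n) m = if m = n then (1 : ℂ) else 0 := by
  simp [e, Pi.single_apply]

lemma inner_e_e (n m : ℕ) : inner ℂ (e n) (e m) = if n = m then (1 : ℂ) else 0 := by
  rw [inner_e_left, e_apply]

lemma norm_e (n : ℕ) : ‖e n‖ = 1 := by
  simp [e, lp.norm_single]

lemma hasSum_e (x : ℓ2) : HasSum (fun n => (inner ℂ (e n) x : ℂ) • e n) x := by
  have := lp.hasSum_single (p := 2) (by simp) x
  convert this using 2 with n
  rw [inner_e_left, e, ← lp.single_smul]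
  simp

lemma clm_ext_e {S T : ℓ2 →L[ℂ] ℓ2} (h : ∀ n, S (e n) = T (e n)) : S = T := by
  ext1 x
  have h1 := (hasSum_e x).mapL S
  have h2 := (hasSum_e x).mapL T
  simp only [map_smul, h] at h1 h2
  exact h1.unique h2

lemma vec_ext_e {x y : ℓ2} (h : ∀ n, (inner ℂ (e n) x : ℂ) = inner ℂ (e n) y) : x = y := by
  have h1 := hasSum_e x
  simp only [h] at h1
  exact h1.unique (hasSum_e y)

lemma hasSum_RO (T : ℓ2 →L[ℂ] ℓ2) (h : Summable fun n => ‖T (e n)‖) :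
    HasSum (fun n => RO (T (e n)) (e n)) T := by
  have hs : Summable (fun n => RO (T (e n)) (e n)) := by
    apply Summable.of_norm
    simpa [norm_rankOne, norm_e] using h
  obtain ⟨S, hS⟩ := hs
  have : S = T := by
    apply clm_ext_e
    intro n
    have h1 := hS.mapL (ContinuousLinearMap.apply ℂ ℓ2 (e n))
    have h2 : HasSum (fun m => (RO (T (e m)) (e m)) (e n)) (T (e n)) := by
      have := hasSum_single (f := fun m => (RO (T (e m)) (e m)) (e n)) n (by
        intro m hm
        simp [inner_e_e, hm])
      simpa [inner_e_e, norm_e] using this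
    exact h1.unique h2
  exact this ▸ hS

lemma norm_le_tsum (T : ℓ2 →L[ℂ] ℓ2) (h : Summable fun n => ‖T (e n)‖) :
    ‖T‖ ≤ ∑' n, ‖T (e n)‖ := by
  have h1 := hasSum_RO T h
  have h2 : ∀ n, ‖RO (T (e n)) (e n)‖ = ‖T (e n)‖ := by
    intro n; simp [norm_rankOne, norm_e]
  rw [← h1.tsum_eq]
  refine (norm_tsum_le_tsum_norm (by simpa only [h2] using h)).trans (le_of_eq ?_)
  exact tsum_congr (fun n => by rw [h1.tsum_eq, h2])

lemma compact_RO (x y : ℓ2) : IsCompactOperator (RO x y) := by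
  have h : IsCompactOperator (innerSL ℂ y : ℓ2 →L[ℂ] ℂ) :=
    isCompactOperator_of_locallyCompactSpace_dom (innerSL ℂ y : ℓ2 →L[ℂ] ℂ)
  exact h.clm_comp (ContinuousLinearMap.toSpanSingleton ℂ x)

lemma compact_of_summable (T : ℓ2 →L[ℂ] ℓ2) (h : Summable fun n => ‖T (e n)‖) :
    IsCompactOperator T := by
  refine isCompactOperator_of_tendsto (hasSum_RO T h) (Eventually.of_forall fun s => ?_)
  exact sum_mem (S := compactOperator (RingHom.id ℂ) ℓ2 ℓ2) (fun n _ => compact_RO _ _)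

def PN (N : ℕ) : ℓ2 →L[ℂ] ℓ2 := ∑ i ∈ Finset.range N, RO (e i) (e i)

lemma PN_tendsto (x : ℓ2) : Tendsto (fun N => PN N x) atTop (𝓝 x) := by
  have := (hasSum_e x).tendsto_sum_nat
  simpa [PN, sum_apply] using this

lemma PN_bound : ∃ C, ∀ N, ‖PN N‖ ≤ C := by
  apply banach_steinhaus
  intro x
  obtain ⟨C, hC⟩ := (PN_tendsto x).norm.bddAbove_range
  exact ⟨C, fun i => hC ⟨i, rfl⟩⟩

lemma PN_comp_tendsto (K : ℓ2 →L[ℂ] ℓ2) (hK : IsCompactOperator K) :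
    Tendsto (fun N => PN N * K) atTop (𝓝 K) := by
  obtain ⟨C, hC⟩ := PN_bound
  have hC0 : 0 ≤ C := (norm_nonneg _).trans (hC 0)
  rw [Metric.tendsto_atTop]
  intro ε hε
  obtain ⟨S, hS, hsub⟩ := hK.image_closedBall_subset_compact (f := (K : ℓ2 →ₗ[ℂ] ℓ2)) 1
  set δ := ε / (2 * (C + 2)) with hδ
  have hδ0 : 0 < δ := by positivity
  obtain ⟨t, htS, htf, hcov⟩ := hS.finite_cover_balls hδ0
  have hev : ∀ᶠ N in atTop, ∀ y ∈ t, ‖PN N y - y‖ < δ := by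
    rw [htf.eventually_all]
    intro y _
    have := Metric.tendsto_nhds.1 (PN_tendsto y) δ hδ0
    simpa [dist_eq_norm] using this
  obtain ⟨N0, hN0⟩ := eventually_atTop.1 hev
  refine ⟨N0, fun N hN => ?_⟩
  rw [dist_eq_norm]
  have : ‖PN N * K - K‖ ≤ ε / 2 := by
    refine ContinuousLinearMap.opNorm_le_of_unit_norm (𝕜 := ℂ) (by positivity) ?_
    intro x hx
    have hx' : K x ∈ S := hsub ⟨x, by simp [hx], rfl⟩
    obtain ⟨y, hy, hxy⟩ := Set.mem_iUnion₂.1 (hcov hx')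
    rw [Metric.mem_ball, dist_eq_norm] at hxy
    have h1 := hN0 N hN y hy
    have h2 : ‖PN N (K x - y)‖ ≤ C * δ :=
      ((PN N).le_opNorm _).trans (mul_le_mul (hC N) hxy.le (norm_nonneg _) hC0)
    have h3 : (PN N * K - K) x = PN N (K x - y) + (PN N y - y) - (K x - y) := by
      simp
    rw [h3]
    calc _ ≤ ‖PN N (K x - y)‖ + ‖PN N y - y‖ + ‖K x - y‖ :=
          (norm_sub_le _ _).trans (by gcongr; exact norm_add_le _ _)
      _ ≤ C * δ + δ + δ := by linarith
      _ = ε / 2 := by rw [hδ]; field_simp; ring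
  linarith

lemma map_Hsub {l : ℕ} {s : Fin l} {T : ℓ2 →L[ℂ] ℓ2}
    (h : ∀ p : ℕ, T (e (l * p + s)) ∈ Hsub l s) : ∀ x ∈ Hsub l s, T x ∈ Hsub l s := by
  have hcl : IsClosed (Hsub l s : Set ℓ2) := Submodule.isClosed_topologicalClosure _
  have h1 : Hsub l s ≤ (Hsub l s).comap (T : ℓ2 →ₗ[ℂ] ℓ2) := by
    refine Submodule.topologicalClosure_minimal _ ?_ (hcl.preimage T.continuous)
    rw [Submodule.span_le]
    rintro _ ⟨p, rfl⟩
    exact h p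
  exact h1

lemma e_mem_Hsub {l : ℕ} (s : Fin l) (p : ℕ) : e (l * p + s) ∈ Hsub l s :=
  Submodule.le_topologicalClosure _ (Submodule.subset_span ⟨p, rfl⟩)

lemma star_apply_inner (T : ℓ2 →L[ℂ] ℓ2) (x y : ℓ2) :
    (inner ℂ x (star T y) : ℂ) = inner ℂ (T x) y := by
  rw [ContinuousLinearMap.star_eq_adjoint, ContinuousLinearMap.adjoint_inner_right]

def W (l : ℕ) : Submodule ℂ (ℓ2 →L[ℂ] ℓ2) where
  carrier := {K | IsCompactOperator K ∧ IsCompactOperator (star K : ℓ2 →L[ℂ] ℓ2) ∧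
    ∀ s : Fin l, (∀ x ∈ Hsub l s, K x ∈ Hsub l s) ∧ (∀ x ∈ Hsub l s, (star K) x ∈ Hsub l s)}
  zero_mem' := by
    refine ⟨isCompactOperator_zero, ?_, fun s => ⟨fun x hx => ?_, fun x hx => ?_⟩⟩
    · rw [star_zero]; exact isCompactOperator_zero
    · simp
    · simp
  add_mem' := by
    rintro S T ⟨h1, h2, h3⟩ ⟨h1', h2', h3'⟩
    refine ⟨h1.add h1', ?_, fun s => ⟨fun x hx => ?_, fun x hx => ?_⟩⟩
    · rw [star_add]; exact h2.add h2'
    · exact add_mem ((h3 s).1 x hx) ((h3' s).1 x hx)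
    · rw [star_add]; exact add_mem ((h3 s).2 x hx) ((h3' s).2 x hx)
  smul_mem' := by
    rintro c T ⟨h1, h2, h3⟩
    refine ⟨h1.smul c, ?_, fun s => ⟨fun x hx => ?_, fun x hx => ?_⟩⟩
    · rw [star_smul]; exact h2.smul (star c)
    · exact Submodule.smul_mem _ _ ((h3 s).1 x hx)
    · rw [star_smul]; exact Submodule.smul_mem _ _ ((h3 s).2 x hx)

lemma W_mul {l : ℕ} {S T : ℓ2 →L[ℂ] ℓ2} (hS : S ∈ W l) (hT : T ∈ W l) : S * T ∈ W l := by
  obtain ⟨h1, h2, h3⟩ := hS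
  obtain ⟨h1', h2', h3'⟩ := hT
  refine ⟨h1.comp_clm T, ?_, fun s => ⟨fun x hx => ?_, fun x hx => ?_⟩⟩
  · rw [star_mul]; exact h2'.comp_clm (star S)
  · exact (h3 s).1 _ ((h3' s).1 x hx)
  · rw [star_mul]; exact (h3' s).2 _ ((h3 s).2 x hx)

lemma W_star {l : ℕ} {S : ℓ2 →L[ℂ] ℓ2} (hS : S ∈ W l) : star S ∈ W l := by
  obtain ⟨h1, h2, h3⟩ := hS
  refine ⟨h2, by rwa [star_star], fun s => ⟨(h3 s).2, ?_⟩⟩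
  rw [star_star]; exact (h3 s).1

lemma W_closed (l : ℕ) : IsClosed (W l : Set (ℓ2 →L[ℂ] ℓ2)) := by
  have hc : IsClosed {K : ℓ2 →L[ℂ] ℓ2 | IsCompactOperator K} :=
    isClosed_setOfPred_isCompactOperator
  have hst : Continuous (star : (ℓ2 →L[ℂ] ℓ2) → (ℓ2 →L[ℂ] ℓ2)) := continuous_star
  have hH : ∀ s : Fin l, IsClosed {K : ℓ2 →L[ℂ] ℓ2 | ∀ x ∈ Hsub l s, K x ∈ Hsub l s} := by
    intro s
    have hcl : IsClosed (Hsub l s : Set ℓ2) := Submodule.isClosed_topologicalClosure _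
    simp only [Set.ofPred_forall]
    refine isClosed_iInter fun x => isClosed_iInter fun _ => ?_
    exact hcl.preimage (ContinuousLinearMap.apply ℂ ℓ2 x).continuous
  have : (W l : Set (ℓ2 →L[ℂ] ℓ2)) = {K : ℓ2 →L[ℂ] ℓ2 | IsCompactOperator K} ∩
      (star ⁻¹' {K : ℓ2 →L[ℂ] ℓ2 | IsCompactOperator K} ∩
      ⋂ s : Fin l, ({K : ℓ2 →L[ℂ] ℓ2 | ∀ x ∈ Hsub l s, K x ∈ Hsub l s} ∩
        star ⁻¹' {K : ℓ2 →L[ℂ] ℓ2 | ∀ x ∈ Hsub l s, K x ∈ Hsub l s})) := by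
    ext K
    simp only [Set.mem_inter_iff, Set.mem_iInter, Set.mem_preimage, Set.mem_ofPred_eq]
    rfl
  rw [this]
  exact hc.inter ((hc.preimage hst).inter
    (isClosed_iInter fun s => (hH s).inter ((hH s).preimage hst)))

lemma closure_adjoin_sub {l : ℕ} {A B : ℓ2 →L[ℂ] ℓ2} (hA : A ∈ W l) (hB : B ∈ W l) :
    closure ((StarAlgebra.adjoin ℂ {A, B} : StarSubalgebra ℂ (ℓ2 →L[ℂ] ℓ2)) :
        Set (ℓ2 →L[ℂ] ℓ2)) ⊆ {T | ∃ (lam : ℂ) (K : ℓ2 →L[ℂ] ℓ2), K ∈ W l ∧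
          T = lam • (1 : ℓ2 →L[ℂ] ℓ2) + K} := by
  have hcl := Submodule.isClosed_sup_finiteDimensional (W l)
    (Submodule.span ℂ {(1 : ℓ2 →L[ℂ] ℓ2)}) (W_closed l)
  have hset : {T : ℓ2 →L[ℂ] ℓ2 | ∃ (lam : ℂ) (K : ℓ2 →L[ℂ] ℓ2), K ∈ W l ∧
          T = lam • (1 : ℓ2 →L[ℂ] ℓ2) + K} =
      ((W l ⊔ Submodule.span ℂ {(1 : ℓ2 →L[ℂ] ℓ2)} : Submodule ℂ (ℓ2 →L[ℂ] ℓ2)) : Set _) := by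
    ext T
    simp only [Set.mem_ofPred_eq, SetLike.mem_coe, Submodule.mem_sup, Submodule.mem_span_singleton]
    constructor
    · rintro ⟨c, K, hK, rfl⟩
      exact ⟨K, hK, _, ⟨c, rfl⟩, add_comm _ _⟩
    · rintro ⟨K, hK, _, ⟨c, rfl⟩, rfl⟩
      exact ⟨c, K, hK, add_comm _ _⟩
  refine closure_minimal ?_ (hset ▸ hcl)
  intro T hT
  induction hT using StarAlgebra.adjoin_induction with
  | mem x h =>
    rcases h with rfl | rfl
    · exact ⟨0, _, hA, by simp⟩
    · exact ⟨0, _, hB, by simp⟩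
  | algebraMap r => exact ⟨r, 0, zero_mem _, by simp [Algebra.algebraMap_eq_smul_one]⟩
  | add x y _ _ hx hy =>
    obtain ⟨c, K, hK, rfl⟩ := hx
    obtain ⟨d, L, hL, rfl⟩ := hy
    exact ⟨c + d, K + L, add_mem hK hL, by rw [add_smul]; abel⟩
  | mul x y _ _ hx hy =>
    obtain ⟨c, K, hK, rfl⟩ := hx
    obtain ⟨d, L, hL, rfl⟩ := hy
    refine ⟨c * d, c • L + d • K + K * L, add_mem (add_mem (Submodule.smul_mem _ _ hL)
      (Submodule.smul_mem _ _ hK)) (W_mul hK hL), ?_⟩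
    simp only [add_mul, mul_add, smul_mul_assoc, mul_smul_comm, one_mul, mul_one, smul_add, smul_smul]
    rw [mul_comm d c]; abel
  | star x _ hx =>
    obtain ⟨c, K, hK, rfl⟩ := hx
    exact ⟨star c, star K, W_star hK, by simp⟩

lemma sub_closed {l : ℕ} (hl : 0 < l) (C : StarSubalgebra ℂ (ℓ2 →L[ℂ] ℓ2))
    (hC : IsClosed (C : Set (ℓ2 →L[ℂ] ℓ2)))
    (hE : ∀ (s : Fin l) (p p' : ℕ), RO (e (l * p + s)) (e (l * p' + s)) ∈ C)
    (K : ℓ2 →L[ℂ] ℓ2) (hK : IsCompactOperator K)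
    (hb : ∀ s : Fin l, ∀ x ∈ Hsub l s, (star K) x ∈ Hsub l s) : K ∈ C := by
  refine hC.mem_of_tendsto (PN_comp_tendsto K hK) (Eventually.of_forall fun N => ?_)
  rw [PN, Finset.sum_mul]
  refine sum_mem fun i _ => ?_
  have h1 : RO (e i) (e i) * K = RO (e i) (star K (e i)) := by
    ext1 x
    simp [ContinuousLinearMap.star_eq_adjoint, ContinuousLinearMap.adjoint_inner_left]
  rw [h1]
  let s : Fin l := ⟨i % l, Nat.mod_lt _ hl⟩
  have hi : i = l * (i / l) + s := (Nat.div_add_mod i l).symm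
  have key : Hsub l s ≤ {carrier := {y | RO (e i) y ∈ C}
                         zero_mem' := by simp
                         add_mem' := fun {a b} ha hb => by
                            simp only [Set.mem_ofPred_eq, RO, map_add] at *
                            exact add_mem ha hb
                         smul_mem' := fun c x hx => by
                            simp only [Set.mem_ofPred_eq, RO, map_smulₛₗ] at *
                            exact C.smul_mem hx _ : Submodule ℂ ℓ2} := by
    refine Submodule.topologicalClosure_minimal _ ?_ ?_
    · rw [Submodule.span_le]
      rintro _ ⟨p, rfl⟩
      show RO (e i) (e (l * p + s)) ∈ C
      rw [hi]; exact hE s _ _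
    · exact hC.preimage (rankOne ℂ (e i)).continuous
  apply key
  apply hb
  rw [hi]
  exact e_mem_Hsub s _

lemma star_RO (x y : ℓ2) : star (RO x y) = RO y x := by
  rw [ContinuousLinearMap.star_eq_adjoint, RO, adjoint_rankOne]

lemma RO_mul (i j m : ℕ) : RO (e i) (e j) * RO (e j) (e m) = RO (e i) (e m) := by
  ext1 x
  simp [inner_e_e, norm_e]

lemma matrix_units {l : ℕ} (C : StarSubalgebra ℂ (ℓ2 →L[ℂ] ℓ2))
    (B : ℓ2 →L[ℂ] ℓ2) (c : ℕ → ℂ) (hc : ∀ m, c m ≠ 0)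
    (hB : ∀ m : ℕ, B (e (m + l)) = c m • e m) (hBC : B ∈ C)
    (hD : ∀ n, RO (e n) (e n) ∈ C) (s p p' : ℕ) :
    RO (e (l * p + s)) (e (l * p' + s)) ∈ C := by
  have h1 : ∀ m, RO (e m) (e (m + l)) ∈ C := by
    intro m
    have h2 : RO (e m) (e (m + l)) = (c m)⁻¹ • (B * RO (e (m + l)) (e (m + l))) := by
      ext1 x
      simp only [rankOne_apply, ContinuousLinearMap.smul_apply, ContinuousLinearMap.mul_apply,
        map_smul, hB, smul_smul]
      congr 1
      field_simp [hc m]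
    rw [h2]
    exact C.smul_mem (mul_mem hBC (hD _)) _
  have h3 : ∀ p, RO (e s) (e (l * p + s)) ∈ C := by
    intro p
    induction p with
    | zero => simpa using hD s
    | succ p ih =>
      have := mul_mem ih (h1 (l * p + s))
      rw [RO_mul] at this
      convert this using 3
      ring
  have := mul_mem (star_mem (h3 p)) (h3 p')
  rwa [star_RO, RO_mul] at this

lemma diag_units (q : ℝ) (hq0 : 0 < q) (hq1 : q < 1)
    (C : StarSubalgebra ℂ (ℓ2 →L[ℂ] ℓ2))
    (hC : IsClosed (C : Set (ℓ2 →L[ℂ] ℓ2))) (A : ℓ2 →L[ℂ] ℓ2) (hAC : A ∈ C)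
    (hA : ∀ n : ℕ, A (e n) = ((q : ℂ) ^ (2 * (n + 1))) • e n) (n : ℕ) :
    RO (e n) (e n) ∈ C := by
  induction n using Nat.strong_induction_on with
  | _ n ih =>
  have hqc : (q : ℂ) ≠ 0 := by exact_mod_cast hq0.ne'
  have hpow : ∀ N m, (A ^ N) (e m) = ((q : ℂ) ^ (2 * (m + 1))) ^ N • e m := by
    intro N m
    induction N with
    | zero => simp
    | succ N ih' =>
      rw [pow_succ, ContinuousLinearMap.mul_apply, hA, map_smul, ih', smul_smul]
      congr 1; ring
  set T : ℕ → (ℓ2 →L[ℂ] ℓ2) := fun N =>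
    (((q : ℂ) ^ (2 * (n + 1))) ^ (N + 1))⁻¹ • (A ^ (N + 1) * (1 - PN n)) with hT
  have hTC : ∀ N, T N ∈ C := fun N => C.smul_mem (mul_mem (pow_mem hAC _)
    (sub_mem (one_mem _) (sum_mem fun i hi => ih i (Finset.mem_range.1 hi)))) _
  have hPN : ∀ m, PN n (e m) = if m < n then e m else 0 := by
    intro m
    simp [PN, sum_apply, inner_e_e]
  have hTe : ∀ N m, (T N - RO (e n) (e n)) (e m) =
      if n < m then ((q : ℂ) ^ (2 * (m - n))) ^ (N + 1) • e m else 0 := by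
    intro N m
    have : T N (e m) = (((q : ℂ) ^ (2 * (n + 1))) ^ (N + 1))⁻¹ •
        (A ^ (N + 1)) (e m - PN n (e m)) := by simp [hT]
    rw [ContinuousLinearMap.sub_apply, this, hPN, rankOne_apply, inner_e_e]
    rcases lt_trichotomy m n with h | rfl | h
    · simp [h, h.ne', h.not_gt]
    · simp [hpow, smul_smul, hqc]
    · have h' : ¬ m < n := h.not_gt
      simp only [h, h', h.ne, if_true, if_false, sub_zero, hpow, smul_smul, zero_smul]
      congr 1
      obtain ⟨d, rfl⟩ := Nat.exists_eq_add_of_lt h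
      rw [show n + d + 1 - n = d + 1 by omega]
      rw [inv_mul_eq_iff_eq_mul₀ (by positivity)]
      ring
  have hnorm : ∀ N m, ‖(T N - RO (e n) (e n)) (e m)‖ ≤ (q ^ N) * q ^ (m - n) := by
    intro N m
    rw [hTe]
    split_ifs with h
    · rw [norm_smul, norm_e, mul_one, norm_pow, norm_pow, Complex.norm_real, Real.norm_eq_abs,
        abs_of_pos hq0, ← pow_mul, ← pow_add]
      apply pow_le_pow_of_le_one hq0.le hq1.le
      have : 1 ≤ m - n := by omega
      nlinarith
    · simp; positivity
  have hsum : Summable fun m => q ^ (m - n) := by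
    rw [← summable_nat_add_iff n]
    simpa using summable_geometric_of_lt_one hq0.le hq1
  refine hC.mem_of_tendsto (f := T) (b := atTop) ?_ (Eventually.of_forall hTC)
  rw [tendsto_iff_norm_sub_tendsto_zero]
  have hlim : Tendsto (fun N : ℕ => q ^ N * ∑' m, q ^ (m - n)) atTop (𝓝 0) := by
    simpa using (tendsto_pow_atTop_nhds_zero_of_lt_one hq0.le hq1).mul_const (∑' m, q ^ (m - n))
  refine squeeze_zero (fun _ => norm_nonneg _) (fun N => ?_) hlim
  have hs := Summable.of_nonneg_of_le (fun _ => norm_nonneg _) (hnorm N) (hsum.mul_left _)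
  refine (norm_le_tsum _ hs).trans ?_
  rw [← tsum_mul_left]
  exact hs.tsum_le_tsum (hnorm N) (hsum.mul_left _)

lemma A_mem_W (q : ℝ) (hq0 : 0 < q) (hq1 : q < 1) (l : ℕ) (A : ℓ2 →L[ℂ] ℓ2)
    (hA : ∀ n : ℕ, A (e n) = ((q : ℂ) ^ (2 * (n + 1))) • e n) : A ∈ W l := by
  have hst : star A = A := by
    apply clm_ext_e
    intro m
    apply vec_ext_e
    intro n
    rw [star_apply_inner, hA, hA, inner_smul_left, inner_smul_right, inner_e_e]
    split_ifs with h
    · subst h; simp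
    · simp
  have hc : IsCompactOperator A := by
    apply compact_of_summable
    refine Summable.of_nonneg_of_le (fun _ => norm_nonneg _) (fun n => ?_)
      (summable_geometric_of_lt_one hq0.le hq1)
    rw [hA, norm_smul, norm_e, mul_one, norm_pow, Complex.norm_real, Real.norm_eq_abs,
        abs_of_pos hq0]
    exact pow_le_pow_of_le_one hq0.le hq1.le (by omega)
  have hH : ∀ s : Fin l, ∀ x ∈ Hsub l s, A x ∈ Hsub l s := fun s => map_Hsub fun p => by
    rw [hA]; exact Submodule.smul_mem _ _ (e_mem_Hsub s p)
  refine ⟨hc, by rwa [hst], fun s => ⟨hH s, ?_⟩⟩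
  rw [hst]; exact hH s

lemma B_mem_W (q : ℝ) (hq0 : 0 < q) (hq1 : q < 1) (l : ℕ) (B : ℓ2 →L[ℂ] ℓ2)
    (c : ℕ → ℂ) (hc : ∀ m, ‖c m‖ ≤ q ^ m)
    (hB0 : ∀ n : ℕ, n < l → B (e n) = 0)
    (hB : ∀ m : ℕ, B (e (m + l)) = c m • e m) : B ∈ W l := by
  have hst : ∀ m, star B (e m) = star (c m) • e (m + l) := by
    intro m
    apply vec_ext_e
    intro n
    rw [star_apply_inner, inner_smul_right, inner_e_e]
    by_cases hn : n < l
    · rw [hB0 n hn, if_neg (by omega)]; simp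
    · obtain ⟨d, rfl⟩ := Nat.exists_eq_add_of_le' (not_lt.1 hn)
      rw [hB, inner_smul_left, inner_e_e]
      by_cases h : d = m
      · subst h; simp
      · rw [if_neg h, if_neg (by omega)]; simp
  have hg := summable_geometric_of_lt_one hq0.le hq1
  refine ⟨?_, ?_, fun s => ⟨map_Hsub fun p => ?_, map_Hsub fun p => ?_⟩⟩
  · apply compact_of_summable
    rw [← summable_nat_add_iff l]
    refine Summable.of_nonneg_of_le (fun _ => norm_nonneg _) (fun n => ?_) hg
    rw [hB, norm_smul, norm_e, mul_one]; exact hc n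
  · apply compact_of_summable
    refine Summable.of_nonneg_of_le (fun _ => norm_nonneg _) (fun n => ?_) hg
    rw [hst, norm_smul, norm_e, mul_one, norm_star]; exact hc n
  · cases p with
    | zero => rw [hB0 _ (by have := s.2; omega)]; exact zero_mem _
    | succ p =>
      rw [show l * (p + 1) + (s : ℕ) = (l * p + s) + l by ring, hB]
      exact Submodule.smul_mem _ _ (e_mem_Hsub s p)
  · rw [hst, show (l * p + s) + l = l * (p + 1) + (s : ℕ) by ring]
    exact Submodule.smul_mem _ _ (e_mem_Hsub s _)

/-- The C*-algebra `C(WP_q(k,l))`, the norm closure of the unital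
`*`-subalgebra of `B(ℓ²(ℕ))` generated by `Â` and `B̂`, equals
`{λI + K : λ ∈ ℂ, K compact leaving each H_s and its adjoint leaving each H_s invariant}`;
i.e. it is the direct sum of `l` copies of the compacts with adjoined identity. -/
theorem continuous_functions_on_teardrop
    (q : ℝ) (hq0 : 0 < q) (hq1 : q < 1)
    (k l : ℕ) (hk : 0 < k) (hl : 0 < l) (hkl : Nat.Coprime k l)
    (A B : ℓ2 →L[ℂ] ℓ2)
    (hA : ∀ n : ℕ, A (e n) = ((q : ℂ) ^ (2 * (n + 1))) • e n)
    (hB0 : ∀ n : ℕ, n < l → B (e n) = 0)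
    (hB : ∀ m : ℕ, B (e (m + l)) =
      (((q : ℂ) ^ (k * (m + l + 1))) *
        ((∏ r ∈ Finset.range l, Real.sqrt (1 - q ^ (2 * (m + l - r))) : ℝ) : ℂ)) • e m) :
    closure ((StarAlgebra.adjoin ℂ {A, B} : StarSubalgebra ℂ (ℓ2 →L[ℂ] ℓ2)) :
        Set (ℓ2 →L[ℂ] ℓ2))
      = {T : ℓ2 →L[ℂ] ℓ2 | ∃ (lam : ℂ) (K : ℓ2 →L[ℂ] ℓ2), IsCompactOperator K ∧
          (∀ s : Fin l, (∀ x ∈ Hsub l s, K x ∈ Hsub l s) ∧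
            (∀ x ∈ Hsub l s, (star K) x ∈ Hsub l s)) ∧
          T = lam • (1 : ℓ2 →L[ℂ] ℓ2) + K} := by
  set c : ℕ → ℂ := fun m => (((q : ℂ) ^ (k * (m + l + 1))) *
        ((∏ r ∈ Finset.range l, Real.sqrt (1 - q ^ (2 * (m + l - r))) : ℝ) : ℂ)) with hcdef
  have hpos : ∀ m, 0 < ∏ r ∈ Finset.range l, Real.sqrt (1 - q ^ (2 * (m + l - r))) := by
    intro m
    refine Finset.prod_pos fun r hr => Real.sqrt_pos.2 ?_
    have := Finset.mem_range.1 hr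
    have := pow_lt_one₀ hq0.le hq1 (n := 2 * (m + l - r)) (by omega)
    linarith
  have hle : ∀ m, ∏ r ∈ Finset.range l, Real.sqrt (1 - q ^ (2 * (m + l - r))) ≤ 1 := by
    intro m
    refine Finset.prod_le_one (fun r _ => Real.sqrt_nonneg _) fun r _ => ?_
    rw [Real.sqrt_le_one]
    have : 0 < q ^ (2 * (m + l - r)) := by positivity
    linarith
  have hc0 : ∀ m, c m ≠ 0 := by
    intro m
    refine mul_ne_zero (pow_ne_zero _ (by exact_mod_cast hq0.ne')) ?_
    exact_mod_cast (hpos m).ne'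
  have hcn : ∀ m, ‖c m‖ ≤ q ^ m := by
    intro m
    rw [hcdef]
    simp only [norm_mul, norm_pow, Complex.norm_real, Real.norm_eq_abs]
    rw [abs_of_pos hq0, abs_of_pos (hpos m)]
    calc _ ≤ q ^ (k * (m + l + 1)) * 1 := by gcongr; exact hle m
      _ ≤ q ^ m := by
        rw [mul_one]
        apply pow_le_pow_of_le_one hq0.le hq1.le
        nlinarith
  have hAW := A_mem_W q hq0 hq1 l A hA
  have hBW := B_mem_W q hq0 hq1 l B c hcn hB0 hB
  apply Set.Subset.antisymm
  · intro T hT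
    obtain ⟨lam, K, hK, rfl⟩ := closure_adjoin_sub hAW hBW hT
    exact ⟨lam, K, hK.1, hK.2.2, rfl⟩
  · rintro _ ⟨lam, K, hK, hb, rfl⟩
    set C := (StarAlgebra.adjoin ℂ {A, B} : StarSubalgebra ℂ (ℓ2 →L[ℂ] ℓ2)).topologicalClosure
    have hC : IsClosed (C : Set (ℓ2 →L[ℂ] ℓ2)) := StarSubalgebra.isClosed_topologicalClosure _
    have hAC : A ∈ C := StarSubalgebra.le_topologicalClosure _
      (StarAlgebra.subset_adjoin ℂ _ (by simp))
    have hBC : B ∈ C := StarSubalgebra.le_topologicalClosure _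
      (StarAlgebra.subset_adjoin ℂ _ (by simp))
    have hKC : K ∈ C := sub_closed hl C hC
      (fun s p p' => matrix_units C B c hc0 hB hBC (diag_units q hq0 hq1 C hC A hAC hA) s p p')
      K hK (fun s => (hb s).2)
    have : lam • (1 : ℓ2 →L[ℂ] ℓ2) + K ∈ C := add_mem (C.smul_mem (one_mem _) _) hKC
    exact this
end
end
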